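/- Let K ≥ 4 be a real number and M, N positive real numbers. Define the sequence (u_n)_{n≥0} by u_0 = N, u_1 = (K − 1)·N − M, and u_{n+1} = (K − 2)·u_n − u_{n−1} for n ≥ 1. Then u_n > 0 for all n ≥ 0 if and only if M ≤ ((K + √(K² − 4K))/2)·N. -/

import Mathlib

/-- Untruncated irresolvable-subspace dimensions along Chain A:
`u_0 = N`, `u_1 = (K−1)·N − M`, `u_{n+1} = (K−2)·u_n − u_{n−1}`. -/
def uSeq (K M N : ℝ) : ℕ → ℝ
  | 0 => N
  | 1 => (K - 1) * N - M
  | (n + 2) => (K - 2) * uSeq K M N (n + 1) - uSeq K M N n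

/-- If `r` and `s` are the roots of `x² − (K − 2)x + 1`, then `u_{n+1} − r u_n` is geometric
with ratio `s`. -/
theorem uSeq_succ_eq {K r s : ℝ} (M N : ℝ) (hsum : r + s = K - 2) (hprod : r * s = 1) (n : ℕ) :
    uSeq K M N (n + 1) = r * uSeq K M N n + s ^ n * ((s + 1) * N - M) := by
  induction n with
  | zero =>
    simp only [uSeq]
    linear_combination -N * hsum
  | succ n ih =>
    have h : uSeq K M N (n + 1 + 1) = (K - 2) * uSeq K M N (n + 1) - uSeq K M N n := rfl
    rw [h, pow_succ]
    linear_combination s * ih - uSeq K M N (n + 1) * hsum + uSeq K M N n * hprod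

theorem uSeq_pos_iff_of_roots {K r s M N : ℝ} (hN : 0 < N) (hr : 0 < r) (hr1 : r ≤ 1)
    (hs : 1 ≤ s) (hsum : r + s = K - 2) (hprod : r * s = 1) :
    (∀ n : ℕ, 0 < uSeq K M N n) ↔ M ≤ (s + 1) * N := by
  constructor
  · intro hpos
    by_contra! hM
    have bound (n : ℕ) : uSeq K M N n ≤ N - n * (M - (s + 1) * N) := by
      induction n with
      | zero => simp [uSeq]
      | succ n ih =>
        rw [uSeq_succ_eq M N hsum hprod]
        push_cast
        nlinarith [mul_nonneg (sub_nonneg.2 hr1) (hpos n).le,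
          mul_nonneg (sub_nonneg.2 (one_le_pow₀ hs (n := n))) (sub_nonneg.2 hM.le)]
    obtain ⟨n, hn⟩ := Archimedean.arch N (sub_pos.2 hM)
    rw [nsmul_eq_mul] at hn
    linarith [hpos n, bound n]
  · intro hM n
    induction n with
    | zero => simpa [uSeq] using hN
    | succ n ih =>
      rw [uSeq_succ_eq M N hsum hprod]
      have : 0 ≤ (s + 1) * N - M := sub_nonneg.2 hM
      positivity

/-- For `K ≥ 4` and positive reals `M, N`, all terms of the Chain-A
recursion `u_0 = N`, `u_1 = (K−1)N − M`, `u_{n+1} = (K−2)u_n − u_{n−1}` are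
positive iff `M ≤ ((K + √(K² − 4K))/2)·N`. -/
theorem chainA_pos_iff (K M N : ℝ) (hK : 4 ≤ K) (hM : 0 < M) (hN : 0 < N) :
    (∀ n : ℕ, 0 < uSeq K M N n) ↔
      M ≤ (K + Real.sqrt (K ^ 2 - 4 * K)) / 2 * N := by
  have hsq : Real.sqrt (K ^ 2 - 4 * K) ^ 2 = K ^ 2 - 4 * K := Real.sq_sqrt (by nlinarith)
  have hd : 0 ≤ Real.sqrt (K ^ 2 - 4 * K) := Real.sqrt_nonneg _
  set d := Real.sqrt (K ^ 2 - 4 * K)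
  have hs : 1 ≤ (K - 2 + d) / 2 := by linarith
  have hprod : (K - 2 - d) / 2 * ((K - 2 + d) / 2) = 1 := by linear_combination -hsq / 4
  have hr : 0 < (K - 2 - d) / 2 := pos_of_mul_pos_left (by rw [hprod]; exact one_pos) (by linarith)
  have hr1 : (K - 2 - d) / 2 ≤ 1 := by nlinarith
  rw [uSeq_pos_iff_of_roots hN hr hr1 hs (by ring) hprod]
  ring_nf
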